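/- arXiv:1703.04769 — 3 statements merged into one kernel-verified Lean document; each statement's English description precedes it below -/
import Mathlib

section
/- Fix H ≥ 1, labels c : Fin H → ℕ, and a uniformly random permutation σ of Fin H. Say that index i precedes index h if c i < c h, or c i = c h and σ i < σ h. Call h blocking if there exists i < h such that i precedes h. Then for every h, the probability (over the uniform choice of σ) that h is blocking equals 1 − 𝟙{c h = min_{i ≤ h} c i} / |{i : i ≤ h ∧ c i = c h}|, where 𝟙{A} is 1 if A holds and 0 otherwise. -/
lemma argmin_le (H : ℕ) (S : Finset (Fin H)) (a b : Fin H) (ha : a ∈ S) (hb : b ∈ S) :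
    (Finset.univ.filter (fun σ : Equiv.Perm (Fin H) => ∀ i ∈ S, σ a ≤ σ i)).card ≤
    (Finset.univ.filter (fun σ : Equiv.Perm (Fin H) => ∀ i ∈ S, σ b ≤ σ i)).card := by
  apply Finset.card_le_card_of_injOn (fun σ => σ * Equiv.swap a b)
  · intro σ hσ
    simp only [Finset.coe_filter, Finset.mem_univ, true_and, Set.mem_ofPred_eq] at hσ ⊢
    intro i hi
    rw [Equiv.Perm.mul_apply, Equiv.Perm.mul_apply, Equiv.swap_apply_right]
    apply hσ
    rw [Equiv.swap_apply_def]
    split_ifs <;> assumption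
  · intro σ _ τ _ hst
    exact mul_right_cancel hst

lemma argmin_card (H : ℕ) (S : Finset (Fin H)) (a : Fin H) (ha : a ∈ S) :
    S.card * (Finset.univ.filter (fun σ : Equiv.Perm (Fin H) => ∀ i ∈ S, σ a ≤ σ i)).card =
    Fintype.card (Equiv.Perm (Fin H)) := by
  have h1 : ∑ b ∈ S, (Finset.univ.filter
      (fun σ : Equiv.Perm (Fin H) => ∀ i ∈ S, σ b ≤ σ i)).card =
      Fintype.card (Equiv.Perm (Fin H)) := by
    simp_rw [Finset.card_filter]
    rw [Finset.sum_comm]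
    simp_rw [← Finset.card_filter]
    rw [Finset.sum_congr rfl (g := fun _ => 1)]
    · simp
    · intro σ _
      rw [Finset.card_eq_one]
      obtain ⟨m, hm, hmin⟩ := Finset.exists_min_image S σ ⟨a, ha⟩
      refine ⟨m, ?_⟩
      ext x
      simp only [Finset.mem_filter, Finset.mem_singleton]
      constructor
      · rintro ⟨hx, hx'⟩
        exact σ.injective (le_antisymm (hx' m hm) (hmin x hx))
      · rintro rfl
        exact ⟨hm, hmin⟩
  rw [← h1, Finset.sum_congr rfl
    (fun b hb => le_antisymm (argmin_le H S b a hb ha) (argmin_le H S a b ha hb))]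
  simp

/-- For a stack of height `H ≥ 1` with labels `c : Fin H → ℕ` and a uniformly
random permutation `σ` of `Fin H`, index `i` precedes `h` if `c i < c h`, or `c i = c h` and
`σ i < σ h`; `h` is blocking if some `i < h` precedes it. The probability (counting ratio over
all permutations) that `h` is blocking equals
`1 − 𝟙{c h = min_{i ≤ h} c i} / |{i : i ≤ h ∧ c i = c h}|`. -/
theorem stmt_1 (H : ℕ) (hH : 1 ≤ H) (c : Fin H → ℕ) (h : Fin H) :
    ((Finset.univ.filter
        (fun σ : Equiv.Perm (Fin H) =>
          ∃ i < h, c i < c h ∨ (c i = c h ∧ σ i < σ h))).card : ℝ) /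
      (Fintype.card (Equiv.Perm (Fin H))) =
    1 - (if c h = (Finset.Iic h).inf' ⟨h, Finset.mem_Iic.mpr le_rfl⟩ c then (1 : ℝ) else 0) /
        (((Finset.Iic h).filter (fun i => c i = c h)).card : ℝ) := by
  have hN : (Fintype.card (Equiv.Perm (Fin H)) : ℝ) ≠ 0 := by
    exact_mod_cast Fintype.card_ne_zero
  have hmin : (c h = (Finset.Iic h).inf' ⟨h, Finset.mem_Iic.mpr le_rfl⟩ c) ↔
      ∀ i < h, c h ≤ c i := by
    constructor
    · intro e i hi
      rw [e]
      exact Finset.inf'_le _ (Finset.mem_Iic.mpr hi.le)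
    · intro e
      apply le_antisymm
      · apply Finset.le_inf'
        intro i hi
        rcases (Finset.mem_Iic.mp hi).lt_or_eq with hlt | rfl
        · exact e i hlt
        · exact le_rfl
      · exact Finset.inf'_le _ (Finset.mem_Iic.mpr le_rfl)
  by_cases hc : ∀ i < h, c h ≤ c i
  · rw [if_pos (hmin.mpr hc)]
    set S := (Finset.Iic h).filter (fun i => c i = c h) with hS
    have hhS : h ∈ S := by simp [hS]
    have key := argmin_card H S h hhS
    have hS0 : (S.card : ℝ) ≠ 0 := by
      exact_mod_cast (Finset.card_pos.mpr ⟨h, hhS⟩).ne'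
    have hcompl := Finset.card_filter_add_card_filter_not (s := Finset.univ)
      (fun σ : Equiv.Perm (Fin H) => ∃ i < h, c i < c h ∨ (c i = c h ∧ σ i < σ h))
    have heq : Finset.univ.filter (fun σ : Equiv.Perm (Fin H) =>
        ¬ ∃ i < h, c i < c h ∨ (c i = c h ∧ σ i < σ h)) =
        Finset.univ.filter (fun σ : Equiv.Perm (Fin H) => ∀ i ∈ S, σ h ≤ σ i) := by
      ext σ
      simp only [Finset.mem_filter, Finset.mem_univ, true_and, hS, Finset.mem_Iic]
      constructor
      · rintro hn i ⟨hi, hci⟩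
        rcases hi.lt_or_eq with hlt | rfl
        · by_contra hlt'
          exact hn ⟨i, hlt, Or.inr ⟨hci, not_le.mp hlt'⟩⟩
        · exact le_rfl
      · rintro hn ⟨i, hi, hlt | ⟨hci, hlt⟩⟩
        · exact absurd (hc i hi) (not_le.mpr hlt)
        · exact absurd (hn i ⟨hi.le, hci⟩) (not_le.mpr hlt)
    rw [heq, Finset.card_univ] at hcompl
    have k1 := congrArg (Nat.cast (R := ℝ)) key
    have k2 := congrArg (Nat.cast (R := ℝ)) hcompl
    rw [Nat.cast_mul] at k1
    rw [Nat.cast_add] at k2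
    rw [div_eq_iff hN, sub_mul, div_mul_eq_mul_div, ← k1, one_mul,
      mul_div_cancel_left₀ _ hS0, k1, ← k2]
    ring
  · rw [if_neg (fun e => hc (hmin.mp e)), zero_div, sub_zero, div_eq_one_iff_eq hN]
    push Not at hc
    obtain ⟨i, hi, hlt⟩ := hc
    rw [Finset.filter_true_of_mem (fun σ _ => ⟨i, hi, Or.inl hlt⟩), Finset.card_univ]
end

section
/- Fix H ≥ 1, labels c : Fin H → ℕ, and a uniformly random permutation σ of Fin H; say i precedes h if c i < c h, or c i = c h and σ i < σ h, and call h blocking if some i < h precedes h. Then the expected number of blocking indices satisfies E[ |{h : h is blocking}| ] = H − Σ_{h=1}^{H} 𝟙{c h = min_{i ≤ h} c i} / |{i : i ≤ h ∧ c i = c h}|. -/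
/-- Each element of `S` is equally likely to be the `σ`-minimum of `S`. -/
theorem count_min {H : ℕ} (S : Finset (Fin H)) (h : Fin H) (hS : h ∈ S) :
    (∑ σ : Equiv.Perm (Fin H), (if ∀ i ∈ S, σ h ≤ σ i then (1 : ℝ) else 0)) * (S.card : ℝ) =
      (Fintype.card (Equiv.Perm (Fin H)) : ℝ) := by
  have key : ∀ j ∈ S, (∑ σ : Equiv.Perm (Fin H), (if ∀ i ∈ S, σ j ≤ σ i then (1 : ℝ) else 0)) =
      ∑ σ : Equiv.Perm (Fin H), (if ∀ i ∈ S, σ h ≤ σ i then (1 : ℝ) else 0) := by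
    intro j hj
    refine Fintype.sum_equiv (Equiv.mulRight (Equiv.swap j h)) _ _ ?_
    intro σ
    have hmem : ∀ i ∈ S, Equiv.swap j h i ∈ S := by
      intro i hi
      rw [Equiv.swap_apply_def]
      split_ifs <;> assumption
    have : (∀ i ∈ S, σ j ≤ σ i) ↔
        ∀ i ∈ S, (Equiv.mulRight (Equiv.swap j h) σ) h ≤
          (Equiv.mulRight (Equiv.swap j h) σ) i := by
      simp only [Equiv.coe_mulRight, Equiv.Perm.mul_apply, Equiv.swap_apply_right]
      constructor
      · intro H1 i hi
        exact H1 _ (hmem i hi)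
      · intro H1 i hi
        have := H1 _ (hmem i hi)
        rwa [Equiv.swap_apply_self] at this
    simp only [this]
  have h1 : ∑ j ∈ S, (∑ σ : Equiv.Perm (Fin H),
      (if ∀ i ∈ S, σ j ≤ σ i then (1 : ℝ) else 0)) =
      (Fintype.card (Equiv.Perm (Fin H)) : ℝ) := by
    rw [Finset.sum_comm]
    have : ∀ σ : Equiv.Perm (Fin H),
        ∑ j ∈ S, (if ∀ i ∈ S, σ j ≤ σ i then (1 : ℝ) else 0) = 1 := by
      intro σ
      obtain ⟨m, hm, hmin⟩ := Finset.exists_min_image S σ ⟨h, hS⟩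
      rw [Finset.sum_eq_single_of_mem m hm, if_pos hmin]
      intro b hb hbm
      rw [if_neg]
      intro hb'
      exact hbm (σ.injective (le_antisymm (hb' m hm) (hmin b hb)))
    simp [this]
  rw [← h1, Finset.sum_congr rfl key, Finset.sum_const, nsmul_eq_mul, mul_comm]

theorem indicator_aux {P A B : Prop} [Decidable P] [Decidable A] [Decidable B]
    (h : P ↔ ¬ (A ∧ B)) :
    (((if P then 1 else 0 : ℕ)) : ℝ) =
      1 - (if A then (1 : ℝ) else 0) * (if B then (1 : ℝ) else 0) := by
  by_cases hA : A <;> by_cases hB : B <;> simp [h, hA, hB]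

/-- With the setup of a stack of height `H ≥ 1`, labels `c : Fin H → ℕ` and a
uniformly random permutation `σ` of `Fin H` (where `i` precedes `h` iff `c i < c h`, or
`c i = c h` and `σ i < σ h`, and `h` is blocking iff some `i < h` precedes it), the expected
number of blocking indices equals
`H − Σ_h 𝟙{c h = min_{i ≤ h} c i} / |{i : i ≤ h ∧ c i = c h}|`. -/
theorem stmt_2 (H : ℕ) (hH : 1 ≤ H) (c : Fin H → ℕ) :
    (∑ σ : Equiv.Perm (Fin H),
        ((Finset.univ.filter
            (fun h : Fin H =>
              ∃ i < h, c i < c h ∨ (c i = c h ∧ σ i < σ h))).card : ℝ)) /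
      (Fintype.card (Equiv.Perm (Fin H))) =
    (H : ℝ) - ∑ h : Fin H,
      (if c h = (Finset.Iic h).inf' ⟨h, Finset.mem_Iic.mpr le_rfl⟩ c then (1 : ℝ) else 0) /
        (((Finset.Iic h).filter (fun i => c i = c h)).card : ℝ) := by
  have hN : (Fintype.card (Equiv.Perm (Fin H)) : ℝ) ≠ 0 := by
    exact_mod_cast Fintype.card_ne_zero
  have hcard : ∀ σ : Equiv.Perm (Fin H), ((Finset.univ.filter
            (fun h : Fin H =>
              ∃ i < h, c i < c h ∨ (c i = c h ∧ σ i < σ h))).card : ℝ) =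
      ∑ h : Fin H, (1 - (if c h = (Finset.Iic h).inf' ⟨h, Finset.mem_Iic.mpr le_rfl⟩ c
        then (1 : ℝ) else 0) *
        (if ∀ i ∈ (Finset.Iic h).filter (fun i => c i = c h), σ h ≤ σ i
          then (1 : ℝ) else 0)) := by
    intro σ
    rw [Finset.card_filter, Nat.cast_sum]
    refine Finset.sum_congr rfl fun h _ => ?_
    have hmin : c h = (Finset.Iic h).inf' ⟨h, Finset.mem_Iic.mpr le_rfl⟩ c ↔
        ∀ i ≤ h, c h ≤ c i := by
      constructor
      · intro e i hi
        rw [e]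
        exact Finset.inf'_le c (Finset.mem_Iic.mpr hi)
      · intro e
        refine le_antisymm ?_ (Finset.inf'_le c (Finset.mem_Iic.mpr le_rfl))
        exact Finset.le_inf' _ _ fun i hi => e i (Finset.mem_Iic.mp hi)
    have hiff : (∃ i < h, c i < c h ∨ (c i = c h ∧ σ i < σ h)) ↔
        ¬ (c h = (Finset.Iic h).inf' ⟨h, Finset.mem_Iic.mpr le_rfl⟩ c ∧
          ∀ i ∈ (Finset.Iic h).filter (fun i => c i = c h), σ h ≤ σ i) := by
      rw [hmin]
      simp only [Finset.mem_filter, Finset.mem_Iic]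
      constructor
      · rintro ⟨i, hi, h1 | ⟨h1, h2⟩⟩ ⟨h3, h4⟩
        · exact absurd (h3 i hi.le) (not_le.mpr h1)
        · exact absurd (h4 i ⟨hi.le, h1⟩) (not_le.mpr h2)
      · intro hn
        by_contra hc
        push Not at hc
        refine hn ⟨fun i hi => ?_, fun i hi => ?_⟩
        · rcases hi.eq_or_lt with rfl | hlt
          · exact le_rfl
          · exact (hc i hlt).1
        · rcases hi.1.eq_or_lt with rfl | hlt
          · exact le_rfl
          · exact (hc i hlt).2 hi.2
    exact indicator_aux hiff
  simp only [hcard]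
  rw [Finset.sum_comm]
  simp only [Finset.sum_sub_distrib, ← Finset.mul_sum]
  rw [sub_div]
  congr 1
  · simp [hN]
  · rw [Finset.sum_div]
    refine Finset.sum_congr rfl fun h _ => ?_
    have hmem : h ∈ (Finset.Iic h).filter (fun i => c i = c h) := by simp
    have hS : (((Finset.Iic h).filter (fun i => c i = c h)).card : ℝ) ≠ 0 := by
      exact_mod_cast (Finset.card_pos.mpr ⟨h, hmem⟩).ne'
    rw [div_eq_div_iff hN hS, mul_assoc, count_min _ h hmem]
end

section
/- Fix H ≥ 1 and labels c : Fin H → ℕ, and let K = min_{i} c i be the minimum label. For each permutation τ of Fin H, define a random precedence using a uniformly random permutation σ of Fin H: index i precedes index h if c i < c h, or c i = c h = K and τ i < τ h, or c i = c h ≠ K and σ i < σ h; call h blocking if some i < h precedes h, and let b_τ = E_σ[ |{h : h is blocking}| ]. Then the minimum of b_τ over all permutations τ equals (H − C_K) − Σ_{h : c h ≠ K} 𝟙{c h = min_{i ≤ h} c i} / |{i : i ≤ h ∧ c i = c h}|, where C_K = |{i : c i = K}|. -/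
lemma aux_count {H : ℕ} (S : Finset (Fin H)) (h : Fin H) (hS : h ∈ S) :
    (Finset.univ.filter (fun σ : Equiv.Perm (Fin H) => ∀ i ∈ S, σ h ≤ σ i)).card * S.card =
      Fintype.card (Equiv.Perm (Fin H)) := by
  classical
  have h1 : ∀ a ∈ S,
      (Finset.univ.filter (fun σ : Equiv.Perm (Fin H) => ∀ i ∈ S, σ a ≤ σ i)).card =
      (Finset.univ.filter (fun σ : Equiv.Perm (Fin H) => ∀ i ∈ S, σ h ≤ σ i)).card := by
    intro a ha
    have hsw : ∀ i ∈ S, Equiv.swap a h i ∈ S := by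
      intro i hi
      rw [Equiv.swap_apply_def]
      split_ifs <;> assumption
    refine Finset.card_bij' (fun σ _ => σ * Equiv.swap a h) (fun σ _ => σ * Equiv.swap a h)
      ?_ ?_ ?_ ?_
    · intro σ hσ
      simp only [Finset.mem_filter, Finset.mem_univ, true_and, Equiv.Perm.mul_apply,
        Equiv.swap_apply_right] at hσ ⊢
      exact fun i hi => hσ _ (hsw i hi)
    · intro σ hσ
      simp only [Finset.mem_filter, Finset.mem_univ, true_and, Equiv.Perm.mul_apply,
        Equiv.swap_apply_left] at hσ ⊢
      exact fun i hi => hσ _ (hsw i hi)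
    · intro σ _
      simp [mul_assoc]
    · intro σ _
      simp [mul_assoc]
  have h2 : ∑ a ∈ S,
      (Finset.univ.filter (fun σ : Equiv.Perm (Fin H) => ∀ i ∈ S, σ a ≤ σ i)).card =
      Fintype.card (Equiv.Perm (Fin H)) := by
    simp only [Finset.card_filter]
    rw [Finset.sum_comm, Fintype.card_eq_sum_ones]
    refine Finset.sum_congr rfl fun σ _ => ?_
    obtain ⟨m, hm, hmin⟩ := Finset.exists_min_image S σ ⟨h, hS⟩
    rw [Finset.sum_eq_single_of_mem m hm, if_pos hmin]
    intro b hb hbm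
    rw [if_neg]
    intro hb'
    exact hbm (σ.injective (le_antisymm (hb' m hm) (hmin b hb)))
  rw [← h2, Finset.sum_congr rfl h1, Finset.sum_const, smul_eq_mul, mul_comm]

lemma aux_point {H : ℕ} (c : Fin H → ℕ) (K : ℕ) (τ : Equiv.Perm (Fin H)) (h : Fin H)
    (hK : c h ≠ K) :
    (∑ σ : Equiv.Perm (Fin H), if (∃ i < h,
                  c i < c h ∨ (c i = c h ∧ c h = K ∧ τ i < τ h) ∨
                    (c i = c h ∧ c h ≠ K ∧ σ i < σ h)) then (1 : ℝ) else 0) /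
          (Fintype.card (Equiv.Perm (Fin H))) =
    1 - (if c h = (Finset.Iic h).inf' ⟨h, Finset.mem_Iic.mpr le_rfl⟩ c then (1 : ℝ) else 0) /
          (((Finset.Iic h).filter (fun i => c i = c h)).card : ℝ) := by
  classical
  have hN : (Fintype.card (Equiv.Perm (Fin H)) : ℝ) ≠ 0 := by
    exact_mod_cast Fintype.card_ne_zero
  by_cases hm : c h = (Finset.Iic h).inf' ⟨h, Finset.mem_Iic.mpr le_rfl⟩ c
  · have hle : ∀ i ≤ h, c h ≤ c i := by
      intro i hi
      rw [hm]
      exact Finset.inf'_le _ (Finset.mem_Iic.mpr hi)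
    rw [if_pos hm]
    set S := (Finset.Iic h).filter (fun i => c i = c h) with hSdef
    have hS : h ∈ S := by simp [hSdef]
    have hc := aux_count S h hS
    have hS0 : (S.card : ℝ) ≠ 0 := by
      exact_mod_cast (Finset.card_pos.mpr ⟨h, hS⟩).ne'
    have key : ∀ σ : Equiv.Perm (Fin H), (if (∃ i < h,
                  c i < c h ∨ (c i = c h ∧ c h = K ∧ τ i < τ h) ∨
                    (c i = c h ∧ c h ≠ K ∧ σ i < σ h)) then (1 : ℝ) else 0) =
        1 - (if ∀ i ∈ S, σ h ≤ σ i then (1 : ℝ) else 0) := by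
      intro σ
      by_cases hb : ∀ i ∈ S, σ h ≤ σ i
      · rw [if_pos hb, if_neg]
        · norm_num
        · rintro ⟨i, hi, h1 | h1 | h1⟩
          · exact absurd (hle i hi.le) (not_le.mpr h1)
          · exact hK h1.2.1
          · exact absurd (hb i (by simp [hSdef, hi.le, h1.1])) (not_le.mpr h1.2.2)
      · rw [if_neg hb, if_pos]
        · norm_num
        · push Not at hb
          obtain ⟨i, hi, hlt⟩ := hb
          simp only [hSdef, Finset.mem_filter, Finset.mem_Iic] at hi
          refine ⟨i, lt_of_le_of_ne hi.1 ?_, Or.inr (Or.inr ⟨hi.2, hK, hlt⟩)⟩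
          rintro rfl
          exact lt_irrefl _ hlt
    rw [Finset.sum_congr rfl fun σ _ => key σ, Finset.sum_sub_distrib, Finset.sum_boole]
    have hc' : ((Finset.univ.filter
        (fun σ : Equiv.Perm (Fin H) => ∀ i ∈ S, σ h ≤ σ i)).card : ℝ) * S.card =
        Fintype.card (Equiv.Perm (Fin H)) := by exact_mod_cast hc
    simp only [Finset.sum_const, nsmul_eq_mul, mul_one, Finset.card_univ]
    rw [sub_div, div_self hN]
    congr 1
    rw [div_eq_div_iff hN hS0, hc', one_mul]
  · rw [if_neg hm]
    obtain ⟨i, hi, hlt⟩ : ∃ i ≤ h, c i < c h := by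
      by_contra hcon
      push Not at hcon
      apply hm
      apply le_antisymm
      · exact Finset.le_inf' _ _ fun i hi => hcon i (Finset.mem_Iic.mp hi)
      · exact Finset.inf'_le _ (Finset.mem_Iic.mpr le_rfl)
    have hih : i < h := lt_of_le_of_ne hi (by rintro rfl; exact lt_irrefl _ hlt)
    rw [Finset.sum_congr rfl fun σ _ => if_pos ⟨i, hih, Or.inl hlt⟩]
    simp [hN]


/-- Stack of height `H ≥ 1`, labels `c : Fin H → ℕ`, minimum label `K`.
For a revealed order `τ` of the containers of minimal label and a uniformly random
permutation `σ` breaking ties among the other labels, index `i` precedes `h` if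
`c i < c h`, or `c i = c h = K` and `τ i < τ h`, or `c i = c h ≠ K` and `σ i < σ h`;
`h` is blocking if some `i < h` precedes it, and `b_τ` is the expected number of blocking
indices. Then the minimum of `b_τ` over all permutations `τ` equals
`(H − C_K) − Σ_{h : c h ≠ K} 𝟙{c h = min_{i ≤ h} c i} / |{i : i ≤ h ∧ c i = c h}|`,
where `C_K = |{i : c i = K}|`. -/
theorem stmt_3 (H : ℕ) (hH : 0 < H) (c : Fin H → ℕ) (K : ℕ)
    (hK : K = Finset.univ.inf' ⟨⟨0, hH⟩, Finset.mem_univ _⟩ c) :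
    Finset.univ.inf' ⟨(1 : Equiv.Perm (Fin H)), Finset.mem_univ _⟩
      (fun τ : Equiv.Perm (Fin H) =>
        (∑ σ : Equiv.Perm (Fin H),
            ((Finset.univ.filter
                (fun h : Fin H => ∃ i < h,
                  c i < c h ∨ (c i = c h ∧ c h = K ∧ τ i < τ h) ∨
                    (c i = c h ∧ c h ≠ K ∧ σ i < σ h))).card : ℝ)) /
          (Fintype.card (Equiv.Perm (Fin H)))) =
    ((H : ℝ) - ((Finset.univ.filter (fun i : Fin H => c i = K)).card : ℝ)) -
      ∑ h ∈ Finset.univ.filter (fun h : Fin H => c h ≠ K),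
        (if c h = (Finset.Iic h).inf' ⟨h, Finset.mem_Iic.mpr le_rfl⟩ c then (1 : ℝ) else 0) /
          (((Finset.Iic h).filter (fun i => c i = c h)).card : ℝ) := by
  classical
  have hmin : ∀ i, K ≤ c i := fun i => by
    rw [hK]; exact Finset.inf'_le _ (Finset.mem_univ i)
  clear hK
  have hR : ((H : ℝ) - ((Finset.univ.filter (fun i : Fin H => c i = K)).card : ℝ)) -
      ∑ h ∈ Finset.univ.filter (fun h : Fin H => c h ≠ K),
        (if c h = (Finset.Iic h).inf' ⟨h, Finset.mem_Iic.mpr le_rfl⟩ c then (1 : ℝ) else 0) /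
          (((Finset.Iic h).filter (fun i => c i = c h)).card : ℝ) =
      ∑ h ∈ Finset.univ.filter (fun h : Fin H => c h ≠ K), (1 -
        (if c h = (Finset.Iic h).inf' ⟨h, Finset.mem_Iic.mpr le_rfl⟩ c then (1 : ℝ) else 0) /
          (((Finset.Iic h).filter (fun i => c i = c h)).card : ℝ)) := by
    rw [Finset.sum_sub_distrib]
    congr 1
    have := Finset.card_filter_add_card_filter_not (s := (Finset.univ : Finset (Fin H)))
      (fun i : Fin H => c i = K)
    rw [Finset.card_univ, Fintype.card_fin] at this
    have h2 : (((Finset.univ.filter (fun i : Fin H => c i = K)).card : ℝ)) +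
      ((Finset.univ.filter (fun i : Fin H => ¬ c i = K)).card : ℝ) = H := by exact_mod_cast this
    simp only [Finset.sum_const, nsmul_eq_mul, mul_one, ne_eq]
    linarith
  rw [hR]
  have hL : ∀ τ : Equiv.Perm (Fin H), (∑ σ : Equiv.Perm (Fin H),
            ((Finset.univ.filter
                (fun h : Fin H => ∃ i < h,
                  c i < c h ∨ (c i = c h ∧ c h = K ∧ τ i < τ h) ∨
                    (c i = c h ∧ c h ≠ K ∧ σ i < σ h))).card : ℝ)) /
          (Fintype.card (Equiv.Perm (Fin H))) =
      ∑ h ∈ Finset.univ.filter (fun h : Fin H => c h = K),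
        (∑ σ : Equiv.Perm (Fin H), if (∃ i < h,
                  c i < c h ∨ (c i = c h ∧ c h = K ∧ τ i < τ h) ∨
                    (c i = c h ∧ c h ≠ K ∧ σ i < σ h)) then (1 : ℝ) else 0) /
          (Fintype.card (Equiv.Perm (Fin H))) +
      ∑ h ∈ Finset.univ.filter (fun h : Fin H => c h ≠ K), (1 -
        (if c h = (Finset.Iic h).inf' ⟨h, Finset.mem_Iic.mpr le_rfl⟩ c then (1 : ℝ) else 0) /
          (((Finset.Iic h).filter (fun i => c i = c h)).card : ℝ)) := by
    intro τ
    rw [← Finset.sum_congr rfl fun h hh => aux_point c K τ h (Finset.mem_filter.mp hh).2]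
    rw [Finset.sum_filter_add_sum_filter_not, ← Finset.sum_div, Finset.sum_comm]
    simp only [Finset.sum_boole]
  apply le_antisymm
  · refine (Finset.inf'_le _ (Finset.mem_univ (Fin.revPerm : Equiv.Perm (Fin H)))).trans ?_
    rw [hL]
    apply le_of_eq
    rw [add_eq_right]
    refine Finset.sum_eq_zero fun h hh => ?_
    have hh' := (Finset.mem_filter.mp hh).2
    rw [Finset.sum_eq_zero, zero_div]
    intro σ _
    rw [if_neg]
    rintro ⟨i, hi, h1 | h1 | h1⟩
    · have := hmin i
      omega
    · have h3 := h1.2.2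
      simp only [Fin.revPerm_apply, Fin.rev_lt_rev] at h3
      exact absurd hi (not_lt.mpr h3.le)
    · exact h1.2.1 hh'
  · refine Finset.le_inf' _ _ fun τ _ => ?_
    rw [hL]
    refine le_add_of_nonneg_left (Finset.sum_nonneg fun h _ => div_nonneg
      (Finset.sum_nonneg fun σ _ => ?_) (Nat.cast_nonneg _))
    split_ifs <;> norm_num
end
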